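/- Each factor of a Sturmian word has either two or three abelian returns. -/

import Mathlib

variable {α : Type*}

/-- The factor of the infinite word `w` of length `n` starting at position `i`. -/
def factorAt (w : ℕ → α) (i n : ℕ) : List α :=
  (List.range n).map fun k => w (i + k)

/-- `u` is a factor of the infinite word `w`. -/
def IsFactor (w : ℕ → α) (u : List α) : Prop :=
  ∃ i, factorAt w i u.length = u

/-- `w` is recurrent: each of its factors occurs infinitely many times. -/
def Recurrent (w : ℕ → α) : Prop :=
  ∀ u : List α, IsFactor w u → ∀ N : ℕ, ∃ i, N ≤ i ∧ factorAt w i u.length = u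

/-- `w` is periodic: there is `T > 0` with `w (n + T) = w n` for all `n`. -/
def Periodic (w : ℕ → α) : Prop :=
  ∃ T : ℕ, 0 < T ∧ ∀ n, w (n + T) = w n

def Aperiodic (w : ℕ → α) : Prop := ¬ Periodic w

def UltimatelyPeriodic (w : ℕ → α) : Prop :=
  ∃ N T : ℕ, 0 < T ∧ ∀ n, N ≤ n → w (n + T) = w n

/-- `w` is Sturmian: aperiodic with subword complexity `n + 1`. -/
def Sturmian (w : ℕ → α) : Prop :=
  Aperiodic w ∧ ∀ n : ℕ, {u : List α | u.length = n ∧ IsFactor w u}.ncard = n + 1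

/-- Positions where `u` occurs in `w`. -/
def Occurrences (w : ℕ → α) (u : List α) : Set ℕ :=
  {i | factorAt w i u.length = u}

/-- The return words of `u` in `w`: words from one occurrence of `u` to the next. -/
def ReturnWords (w : ℕ → α) (u : List α) : Set (List α) :=
  {r | ∃ i j : ℕ, i ∈ Occurrences w u ∧ j ∈ Occurrences w u ∧ i < j ∧
    (∀ k, i < k → k < j → k ∉ Occurrences w u) ∧ r = factorAt w i (j - i)}

/-- Positions where a word abelian-equivalent to `u` occurs in `w`. -/
def AbelianOccurrences (w : ℕ → α) (u : List α) : Set ℕ :=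
  {i | List.Perm (factorAt w i u.length) u}

/-- The abelian return words of `u` in `w`. -/
def AbelianReturnWords (w : ℕ → α) (u : List α) : Set (List α) :=
  {r | ∃ i j : ℕ, i ∈ AbelianOccurrences w u ∧ j ∈ AbelianOccurrences w u ∧ i < j ∧
    (∀ k, i < k → k < j → k ∉ AbelianOccurrences w u) ∧ r = factorAt w i (j - i)}

/-- The abelian equivalence classes (as multisets) of the abelian return words of `u` in `w`. -/
def abelianReturnClasses (w : ℕ → α) (u : List α) : Set (Multiset α) :=
  (fun r : List α => (r : Multiset α)) '' AbelianReturnWords w u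

def RightSpecial (w : ℕ → α) (u : List α) : Prop :=
  ∃ a b : α, a ≠ b ∧ IsFactor w (u ++ [a]) ∧ IsFactor w (u ++ [b])

def LeftSpecial (w : ℕ → α) (u : List α) : Prop :=
  ∃ a b : α, a ≠ b ∧ IsFactor w (a :: u) ∧ IsFactor w (b :: u)

def Bispecial (w : ℕ → α) (u : List α) : Prop :=
  RightSpecial w u ∧ LeftSpecial w u

/-- A factor is singular if it is the only factor of `w` in its abelian class. -/
def Singular (w : ℕ → α) (u : List α) : Prop :=
  ∀ v : List α, IsFactor w v → List.Perm v u → v = u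

/-- `w` is an infinite concatenation of words from `S`. -/
def InfConcat (S : Set (List α)) (w : ℕ → α) : Prop :=
  ∃ f : ℕ → List α, (∀ n, f n ∈ S) ∧
    ∀ n, factorAt w (((List.range n).map fun k => (f k).length).sum) (f n).length = f n

/-- A finite binary word is balanced if any two factors of equal length have numbers
of occurrences of `true` differing by at most one. -/
def BalancedList (w : List Bool) : Prop :=
  ∀ u v : List Bool, u <:+: w → v <:+: w → u.length = v.length →
    |(u.count true : ℤ) - (v.count true : ℤ)| ≤ 1

/-! ### Factors as windows of an infinite word -/

theorem factorAt_succ (w : ℕ → α) (i n : ℕ) :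
    factorAt w i (n + 1) = factorAt w i n ++ [w (i + n)] := by
  simp [factorAt, List.range_succ]

theorem factorAt_length (w : ℕ → α) (i n : ℕ) : (factorAt w i n).length = n := by
  simp [factorAt]

theorem dropLast_factorAt_succ (w : ℕ → α) (i n : ℕ) :
    (factorAt w i (n + 1)).dropLast = factorAt w i n := by
  simp [factorAt_succ]

theorem factorAt_eq_iff (w : ℕ → α) (i j n : ℕ) :
    factorAt w i n = factorAt w j n ↔ ∀ k < n, w (i + k) = w (j + k) := by
  simp [factorAt]

theorem setOf_isFactor_eq_range (w : ℕ → α) (n : ℕ) :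
    {u : List α | u.length = n ∧ IsFactor w u} = Set.range fun i => factorAt w i n := by
  ext u
  constructor
  · rintro ⟨rfl, i, hi⟩
    exact ⟨i, hi⟩
  · rintro ⟨i, rfl⟩
    exact ⟨factorAt_length w i n, i, by rw [factorAt_length]⟩

theorem Sturmian.ncard_range {w : ℕ → α} (hw : Sturmian w) (n : ℕ) :
    (Set.range fun i => factorAt w i n).ncard = n + 1 := by
  rw [← setOf_isFactor_eq_range, hw.2]

theorem Sturmian.finite_range {w : ℕ → α} (hw : Sturmian w) (n : ℕ) :
    (Set.range fun i => factorAt w i n).Finite :=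
  Set.finite_of_ncard_ne_zero (by rw [hw.ncard_range]; omega)

theorem Sturmian.not_ultimatelyPeriodic {w : ℕ → α} (hw : Sturmian w) :
    ¬ UltimatelyPeriodic w := by
  rintro ⟨N, T, hT, h⟩
  have key : ∀ i, ∃ j < N + T, ∀ k, w (i + k) = w (j + k) := by
    intro i
    induction i using Nat.strong_induction_on with
    | _ i ih =>
      by_cases hi : i < N + T
      · exact ⟨i, hi, fun _ => rfl⟩
      · obtain ⟨j, hj, hjk⟩ := ih (i - T) (by omega)
        refine ⟨j, hj, fun k => ?_⟩
        rw [← hjk, ← h (i - T + k) (by omega)]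
        congr 1
        omega
  have hsub : (Set.range fun i => factorAt w i (N + T)) ⊆
      (fun i => factorAt w i (N + T)) '' (Finset.range (N + T) : Set ℕ) := by
    rintro _ ⟨i, rfl⟩
    obtain ⟨j, hj, hjk⟩ := key i
    exact ⟨j, by simpa using hj, ((factorAt_eq_iff w i j _).2 fun k _ => hjk k).symm⟩
  have h1 := Set.ncard_le_ncard hsub ((Finset.finite_toSet _).image _)
  have h2 := Set.ncard_image_le (f := fun i => factorAt w i (N + T))
    (Finset.finite_toSet (Finset.range (N + T)))
  rw [hw.ncard_range] at h1
  rw [Set.ncard_coe_finset, Finset.card_range] at h2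
  omega

/-- The window of length `n` at position `i` is a right special factor. -/
def SpecialAt (w : ℕ → α) (n i : ℕ) : Prop :=
  ∃ j, (∀ k < n, w (i + k) = w (j + k)) ∧ w (i + n) ≠ w (j + n)

theorem SpecialAt.succ {w : ℕ → α} {n i : ℕ} (h : SpecialAt w (n + 1) i) :
    SpecialAt w n (i + 1) := by
  obtain ⟨j, hj, hne⟩ := h
  refine ⟨j + 1, fun k hk => ?_, ?_⟩
  · simpa [add_assoc, add_comm 1] using hj (k + 1) (by omega)
  · simpa [add_assoc, add_comm 1] using hne

theorem Sturmian.exists_specialAt {w : ℕ → α} (hw : Sturmian w) (n : ℕ) :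
    ∃ i, SpecialAt w n i := by
  obtain ⟨_, ⟨i, rfl⟩, _, ⟨j, rfl⟩, hne, heq⟩ :=
    Set.exists_ne_map_eq_of_ncard_lt_of_maps_to
      (s := Set.range fun i => factorAt w i (n + 1)) (t := Set.range fun i => factorAt w i n)
      (by rw [hw.ncard_range, hw.ncard_range]; omega) (f := List.dropLast)
      (by rintro _ ⟨i, rfl⟩; exact ⟨i, (dropLast_factorAt_succ w i n).symm⟩)
      (hw.finite_range n)
  simp only [dropLast_factorAt_succ] at heq
  refine ⟨i, j, (factorAt_eq_iff w i j n).1 heq, fun h => hne ?_⟩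
  simp only [factorAt_succ, heq, h]

theorem Sturmian.specialAt_unique {w : ℕ → α} (hw : Sturmian w) {n i j : ℕ}
    (hi : SpecialAt w n i) (hj : SpecialAt w n j) : factorAt w i n = factorAt w j n := by
  by_contra hne
  have hlast : ∀ i j, factorAt w i (n + 1) = factorAt w j (n + 1) →
      factorAt w i n = factorAt w j n ∧ w (i + n) = w (j + n) := by
    intro i j h
    simpa [factorAt_succ] using h
  obtain ⟨i', hi', hin⟩ := hi
  obtain ⟨j', hj', hjn⟩ := hj
  rw [← factorAt_eq_iff] at hi' hj'
  set G := Set.range fun i => factorAt w i (n + 1)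
  have hGfin : G.Finite := hw.finite_range (n + 1)
  set P : Set (List α) := {factorAt w i (n + 1), factorAt w j (n + 1)}
  have hP : P.ncard = 2 := Set.ncard_pair fun h => hne (hlast _ _ h).1
  have hPG : P ⊆ G := by
    rintro x (rfl | rfl)
    · exact ⟨i, rfl⟩
    · exact ⟨j, rfl⟩
  have hsub : (Set.range fun i => factorAt w i n) ⊆ List.dropLast '' (G \ P) := by
    rintro _ ⟨k, rfl⟩
    by_cases hk : factorAt w k (n + 1) ∈ P
    · rcases hk with hk | hk
      · refine ⟨factorAt w i' (n + 1), ⟨⟨i', rfl⟩, ?_⟩, ?_⟩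
        · rintro (h | h)
          · exact hin (hlast _ _ h).2.symm
          · exact hne (hi'.trans (hlast _ _ h).1)
        · exact (dropLast_factorAt_succ _ _ _).trans (hi'.symm.trans (hlast _ _ hk).1.symm)
      · refine ⟨factorAt w j' (n + 1), ⟨⟨j', rfl⟩, ?_⟩, ?_⟩
        · rintro (h | h)
          · exact hne ((hlast _ _ h).1.symm.trans hj'.symm)
          · exact hjn (hlast _ _ h).2.symm
        · exact (dropLast_factorAt_succ _ _ _).trans (hj'.symm.trans (hlast _ _ hk).1.symm)
    · exact ⟨factorAt w k (n + 1), ⟨⟨k, rfl⟩, hk⟩, dropLast_factorAt_succ w k n⟩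
  have h1 := Set.ncard_le_ncard hsub (hGfin.sdiff.image _)
  have h2 := Set.ncard_image_le (f := List.dropLast) (hGfin.sdiff (t := P))
  have h3 := Set.ncard_sdiff_add_ncard_of_subset hPG hGfin
  have h4 : G.ncard = n + 2 := hw.ncard_range (n + 1)
  rw [hw.ncard_range] at h1
  omega

/-- `n + 1` consecutive windows of length `n` must include the right special one. -/
theorem Sturmian.exists_window_eq {w : ℕ → α} (hw : Sturmian w) {n r : ℕ}
    (hr : SpecialAt w n r) (q : ℕ) : ∃ k ≤ n, factorAt w (q + k) n = factorAt w r n := by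
  by_contra! hne
  obtain ⟨s, hs, t, ht, hst, heq⟩ : ∃ s ∈ (Finset.range (n + 1) : Set ℕ),
      ∃ t ∈ (Finset.range (n + 1) : Set ℕ), s ≠ t ∧
        factorAt w (q + s) n = factorAt w (q + t) n := by
    refine Set.exists_ne_map_eq_of_ncard_lt_of_maps_to
      (t := (Set.range fun i => factorAt w i n) \ {factorAt w r n}) ?_ (fun k hk => ?_)
      (hw.finite_range n).sdiff
    · have := Set.ncard_sdiff_singleton_add_one (a := factorAt w r n)
        (s := Set.range fun i => factorAt w i n) ⟨r, rfl⟩ (hw.finite_range n)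
      have hcard := hw.ncard_range n
      rw [Set.ncard_coe_finset, Finset.card_range]
      omega
    · exact ⟨⟨q + k, rfl⟩, hne k (by simpa [Nat.lt_succ_iff] using hk)⟩
  simp only [Finset.coe_range, Set.mem_Iio] at hs ht
  wlog hlt : s < t generalizing s t
  · exact this t s hst.symm heq.symm ht hs (by omega)
  obtain ⟨T, rfl⟩ : ∃ T, t = s + T := ⟨t - s, by omega⟩
  have key : ∀ m, factorAt w (q + s + m) n = factorAt w (q + s + m + T) n ∧
      factorAt w (q + s + m) n ≠ factorAt w r n := by
    intro m
    induction m using Nat.strong_induction_on with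
    | _ m ih =>
      have hnr : ∀ l ≤ m, factorAt w (q + s + l) n ≠ factorAt w r n := by
        intro l hl
        by_cases hlT : l < T
        · rw [add_assoc]
          exact hne _ (by omega)
        · obtain ⟨h1, h2⟩ := ih (l - T) (by omega)
          rw [h1] at h2
          convert h2 using 2
          omega
      refine ⟨?_, hnr m le_rfl⟩
      rcases m with _ | m
      · simpa [add_assoc] using heq
      · have hm := (factorAt_eq_iff _ _ _ _).1 (ih m (by omega)).1
        have hmn : w (q + s + m + n) = w (q + s + m + T + n) := by
          by_contra hmn
          exact hnr m (by omega) (hw.specialAt_unique ⟨_, hm, hmn⟩ hr)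
        rw [factorAt_eq_iff]
        intro k hk
        have hk' : w (q + s + m + (k + 1)) = w (q + s + m + T + (k + 1)) := by
          rcases Nat.lt_or_ge (k + 1) n with h | h
          · exact hm _ h
          · rw [show k + 1 = n by omega]
            exact hmn
        convert hk' using 2 <;> omega
  have hper : ∀ m, w (q + s + n + m + T) = w (q + s + n + m) := by
    intro m
    by_contra hmn
    refine (key m).2 (hw.specialAt_unique
      ⟨q + s + m + T, (factorAt_eq_iff _ _ _ _).1 (key m).1, fun h => hmn ?_⟩ hr)
    convert h.symm using 2 <;> omega
  refine hw.not_ultimatelyPeriodic ⟨q + s + n, T, by omega, fun m hm => ?_⟩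
  have := hper (m - (q + s + n))
  rwa [show q + s + n + (m - (q + s + n)) = m by omega] at this

/-! ### Balance -/

/-- The number of occurrences of `true` in the prefix of length `n`. -/
def prefixCount (w : ℕ → Bool) (n : ℕ) : ℤ :=
  ∑ k ∈ Finset.range n, if w k then 1 else 0

theorem prefixCount_succ (w : ℕ → Bool) (n : ℕ) :
    prefixCount w (n + 1) = prefixCount w n + if w n then 1 else 0 :=
  Finset.sum_range_succ _ _

theorem count_factorAt (w : ℕ → Bool) (i n : ℕ) :
    ((factorAt w i n).count true : ℤ) = prefixCount w (i + n) - prefixCount w i := by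
  induction n with
  | zero => simp [factorAt]
  | succ n ih =>
    rw [factorAt_succ, List.count_append, ← add_assoc, prefixCount_succ]
    push_cast
    rw [ih]
    cases w (i + n) <;> simp
    ring

theorem apply_eq_of_prefixCount {w : ℕ → Bool} {i j : ℕ}
    (h : prefixCount w (i + 1) - prefixCount w i = prefixCount w (j + 1) - prefixCount w j) :
    w i = w j := by
  rw [prefixCount_succ, prefixCount_succ] at h
  cases hi : w i <;> cases hj : w j <;> simp_all

theorem Sturmian.false_of_palindrome {w : ℕ → Bool} (hw : Sturmian w) {n r q : ℕ}
    (hn : 0 < n) (hr : SpecialAt w n r) (hqr : w q ≠ w r) (hqn : w (q + n) = w q)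
    (hpal : ∀ k, 0 < k → k < n → w (q + k) = w (q + (n - k)))
    (htail : ∀ k, 0 < k → k < n → w (r + k) = w (q + k)) : False := by
  obtain ⟨k, hkn, hk⟩ := hw.exists_window_eq hr q
  rw [factorAt_eq_iff] at hk
  rcases Nat.eq_zero_or_pos k with rfl | hk0
  · exact hqr (by simpa using hk 0 hn)
  have h0 : w (q + k) = w r := by simpa using hk 0 hn
  rcases hkn.eq_or_lt with rfl | hlt
  · exact hqr (hqn ▸ h0)
  · have h1 := hk (n - k) (by omega)
    rw [show q + k + (n - k) = q + n by omega, htail _ (by omega) (by omega),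
      ← hpal k hk0 hlt, h0, hqn] at h1
    exact hqr h1

theorem Sturmian.balanced {w : ℕ → Bool} (hw : Sturmian w) (l a b : ℕ) :
    prefixCount w (a + l) - prefixCount w a - (prefixCount w (b + l) - prefixCount w b) ≤ 1 := by
  induction l using Nat.strong_induction_on generalizing a b with
  | _ l ih =>
    by_contra! hlt
    rename' a => i, b => j
    set S := prefixCount w with hS
    have hl : 2 ≤ l := by
      rcases l with _ | _ | l
      · simp at hlt
      · simp only [hS, zero_add, prefixCount_succ] at hlt
        split_ifs at hlt <;> omega
      · omega
    obtain ⟨n, rfl⟩ : ∃ n, l = n + 1 := ⟨l - 1, by omega⟩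
    have hD : ∀ k, 0 < k → k ≤ n → S (i + k) - S i - (S (j + k) - S j) = 1 := by
      intro k hk hkn
      have h1 := ih k (by omega) i j
      have h2 := ih (n + 1 - k) (by omega) (i + k) (j + k)
      rw [show i + k + (n + 1 - k) = i + (n + 1) by omega,
        show j + k + (n + 1 - k) = j + (n + 1) by omega] at h2
      omega
    have hstep : ∀ m, S (m + 1) = S m + if w m then 1 else 0 := prefixCount_succ w
    have hi0 : w i = true := by
      have h1 := hD 1 one_pos (by omega)
      rw [hstep, hstep] at h1
      split_ifs at h1 <;> first | assumption | omega
    have hj0 : w j = false := by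
      have h1 := hD 1 one_pos (by omega)
      rw [hstep, hstep] at h1
      split_ifs at h1 <;> simp_all
    have hDn := hD n (by omega) le_rfl
    have hin : w (i + n) = true := by
      rw [← add_assoc, ← add_assoc, hstep, hstep] at hlt
      split_ifs at hlt <;> first | assumption | omega
    have hjn : w (j + n) = false := by
      rw [← add_assoc, ← add_assoc, hstep, hstep] at hlt
      split_ifs at hlt <;> first | omega | simp_all
    have hi1 := hstep i
    have hj1 := hstep j
    have hin1 := hstep (i + n)
    have hjn1 := hstep (j + n)
    simp only [hi0, hj0, hin, hjn, if_true, Bool.false_eq_true, if_false, add_zero, add_assoc]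
      at hi1 hj1 hin1 hjn1
    have hcommon : ∀ k, 0 < k → k < n → w (i + k) = w (j + k) := by
      intro k hk hkn
      apply apply_eq_of_prefixCount
      rw [← hS]
      have h1 := hD k hk hkn.le
      have h2 := hD (k + 1) (by omega) hkn
      rw [← add_assoc, ← add_assoc] at h2
      omega
    have hPQ : ∀ k, k < n → S (i + (k + 1)) - S i = 1 + (S (i + n) - S (i + (n - k))) := by
      intro k hk
      have h1 := ih (k + 1) (by omega) i (j + (n - k))
      have h2 := ih (k + 1) (by omega) (i + (n - k)) j
      rw [show j + (n - k) + (k + 1) = j + (n + 1) by omega] at h1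
      rw [show i + (n - k) + (k + 1) = i + (n + 1) by omega] at h2
      have h3 := hD (n - k) (by omega) (by omega)
      have h4 := hD (k + 1) (by omega) (by omega)
      omega
    have hpal : ∀ k, 0 < k → k < n → w (i + k) = w (i + (n - k)) := by
      intro k hk hkn
      apply apply_eq_of_prefixCount
      rw [← hS]
      have h1 := hPQ k hkn
      have h2 := hPQ (k - 1) (by omega)
      rw [show k - 1 + 1 = k by omega, show n - (k - 1) = n - k + 1 by omega] at h2
      rw [add_assoc, add_assoc]
      omega
    obtain ⟨r, hr⟩ := hw.exists_specialAt n
    have htail : ∀ k, 0 < k → k < n → w (r + k) = w (i + k) := by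
      obtain ⟨m, rfl⟩ : ∃ m, n = m + 1 := ⟨n - 1, by omega⟩
      have hi : SpecialAt w m (i + 1) := by
        refine ⟨j + 1, fun k hk => ?_, ?_⟩
        · simpa [add_assoc, add_comm 1] using hcommon (k + 1) (by omega) (by omega)
        · rw [add_assoc, add_assoc, add_comm 1 m, hin, hjn]
          simp
      have := (factorAt_eq_iff _ _ _ _).1 (hw.specialAt_unique hr.succ hi)
      intro k hk hkm
      have h1 := this (k - 1) (by omega)
      rwa [show r + 1 + (k - 1) = r + k by omega, show i + 1 + (k - 1) = i + k by omega] at h1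
    cases hrv : w r with
    | false =>
      exact hw.false_of_palindrome (by omega) hr (q := i) (by simp [hi0, hrv]) (by rw [hin, hi0]) hpal htail
    | true =>
      refine hw.false_of_palindrome (by omega) hr (q := j) (by simp [hj0, hrv]) (by rw [hjn, hj0]) ?_ ?_
      · intro k hk hkn
        rw [← hcommon k hk hkn, ← hcommon (n - k) (by omega) (by omega), hpal k hk hkn]
      · intro k hk hkn
        rw [htail k hk hkn, hcommon k hk hkn]

/-! ### The slope -/

theorem Sturmian.exists_slope {w : ℕ → Bool} (hw : Sturmian w) :
    ∃ α : ℝ, ∀ i n : ℕ, |(prefixCount w (i + n) - prefixCount w i : ℝ) - n * α| ≤ 1 := by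
  set S := prefixCount w with hS
  have hlow : ∀ i n k : ℕ, (k : ℤ) * (S (i + n) - S i - 1) ≤ S (k * n) := by
    intro i n k
    induction k with
    | zero => simp [hS, prefixCount]
    | succ k ih =>
      have := hw.balanced n i (k * n)
      rw [add_mul, one_mul]
      push_cast
      linarith
  have hhigh : ∀ i n k : ℕ, S (k * n) ≤ (k : ℤ) * (S (i + n) - S i + 1) := by
    intro i n k
    induction k with
    | zero => simp [hS, prefixCount]
    | succ k ih =>
      have := hw.balanced n (k * n) i
      rw [add_mul, one_mul]
      push_cast
      linarith
  obtain ⟨α, hα₁, hα₂⟩ := exists_between_of_forall_le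
    (s := {x : ℝ | ∃ i n : ℕ, 0 < n ∧ x = (S (i + n) - S i - 1) / n})
    (t := {x : ℝ | ∃ i n : ℕ, 0 < n ∧ x = (S (i + n) - S i + 1) / n})
    ⟨_, 0, 1, one_pos, rfl⟩ ⟨_, 0, 1, one_pos, rfl⟩ (by
      rintro _ ⟨i, n, hn, rfl⟩ _ ⟨j, k, hk, rfl⟩
      rw [div_le_div_iff₀ (by exact_mod_cast hn) (by exact_mod_cast hk)]
      have h := (hlow i n k).trans (mul_comm k n ▸ hhigh j k n)
      have h' : (k : ℝ) * (S (i + n) - S i - 1) ≤ n * (S (j + k) - S j + 1) := by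
        exact_mod_cast h
      linarith)
  refine ⟨α, fun i n => ?_⟩
  rcases Nat.eq_zero_or_pos n with rfl | hn
  · simp
  have hn' : (0 : ℝ) < n := by exact_mod_cast hn
  have h1 := hα₁ ⟨i, n, hn, rfl⟩
  have h2 := hα₂ ⟨i, n, hn, rfl⟩
  rw [div_le_iff₀ hn'] at h1
  rw [le_div_iff₀ hn'] at h2
  rw [abs_le]
  constructor <;> linarith

theorem exists_forall_ge_eq_zero {e : ℕ → ℤ} (he : ∀ n, 0 ≤ e n) {B : ℤ}
    (hB : ∀ n, ∑ k ∈ Finset.range n, e k ≤ B) : ∃ N, ∀ n, N ≤ n → e n = 0 := by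
  obtain ⟨_, ⟨N, rfl⟩, hN⟩ := Int.exists_greatest_of_bdd
    (P := fun z => ∃ n, z = ∑ k ∈ Finset.range n, e k)
    ⟨B, by rintro _ ⟨n, rfl⟩; exact hB n⟩ ⟨_, 0, rfl⟩
  refine ⟨N, fun n hn => le_antisymm ?_ (he n)⟩
  have h1 := hN _ ⟨n + 1, rfl⟩
  rw [Finset.sum_range_succ] at h1
  have h2 := Finset.sum_le_sum_of_subset_of_nonneg
    (Finset.range_subset_range.2 hn) (fun k _ _ => he k)
  linarith

theorem Sturmian.irrational_slope {w : ℕ → Bool} (hw : Sturmian w) {α : ℝ}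
    (hα : ∀ i n : ℕ, |(prefixCount w (i + n) - prefixCount w i : ℝ) - n * α| ≤ 1) :
    Irrational α := by
  rintro ⟨x, rfl⟩
  set S := prefixCount w with hS
  set q := x.den
  have hq : 0 < q := x.den_pos
  set p := x.num
  have hx : (q : ℝ) * (x : ℝ) = p := by
    exact_mod_cast Rat.den_mul_eq_num x
  set e : ℕ → ℤ := fun i => S (i + q) - S i - p
  have hsum : ∀ n, ∑ k ∈ Finset.range n, e k =
      ∑ k ∈ Finset.range q, (S (k + n) - S k) - n * p := by
    intro n
    induction n with
    | zero => simp
    | succ n ih =>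
      rw [Finset.sum_range_succ, ih]
      have h1 : ∑ k ∈ Finset.range q, (S (k + (n + 1)) - S (k + n)) = S (q + n) - S (0 + n) := by
        have := Finset.sum_range_sub (fun k => S (k + n)) q
        rw [← this]
        refine Finset.sum_congr rfl fun k _ => ?_
        rw [show k + (n + 1) = k + 1 + n by ring]
      have h2 : ∑ k ∈ Finset.range q, (S (k + (n + 1)) - S k) =
          ∑ k ∈ Finset.range q, (S (k + (n + 1)) - S (k + n)) +
          ∑ k ∈ Finset.range q, (S (k + n) - S k) := by
        rw [← Finset.sum_add_distrib]
        exact Finset.sum_congr rfl fun k _ => by ring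
      rw [h2, h1]
      simp only [e, add_comm q n, zero_add]
      push_cast
      ring
  have hbound : ∀ n, |∑ k ∈ Finset.range n, e k| ≤ q := by
    intro n
    have h1 : ((∑ k ∈ Finset.range n, e k : ℤ) : ℝ) =
        ∑ k ∈ Finset.range q, ((S (k + n) - S k : ℝ) - n * x) := by
      rw [hsum]
      push_cast
      simp only [Finset.sum_sub_distrib, Finset.sum_const, Finset.card_range, nsmul_eq_mul]
      rw [← hx]
      ring
    have h2 : |((∑ k ∈ Finset.range n, e k : ℤ) : ℝ)| ≤ q := by
      rw [h1]
      refine (Finset.abs_sum_le_sum_abs _ _).trans ?_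
      refine (Finset.sum_le_sum fun k _ => hα k n).trans ?_
      simp
    exact_mod_cast h2
  have hzero : ∃ N, ∀ n, N ≤ n → e n = 0 := by
    by_cases hpos : ∀ n, 0 ≤ e n
    · exact exists_forall_ge_eq_zero hpos fun n => (le_abs_self _).trans (hbound n)
    · push Not at hpos
      obtain ⟨m, hm⟩ := hpos
      obtain ⟨N, hN⟩ := exists_forall_ge_eq_zero (e := fun n => - e n) (B := q)
        (fun n => by
          have := hw.balanced q n m
          simp only [e, hS] at hm ⊢
          omega)
        (fun n => by
          rw [Finset.sum_neg_distrib]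
          exact (neg_le_abs _).trans (hbound n))
      exact ⟨N, fun n hn => by simpa using hN n hn⟩
  obtain ⟨N, hN⟩ := hzero
  refine hw.not_ultimatelyPeriodic ⟨N, q, hq, fun n hn => ?_⟩
  apply apply_eq_of_prefixCount
  rw [← hS]
  have h1 := hN n hn
  have h2 := hN (n + 1) (by omega)
  simp only [e] at h1 h2
  rw [show n + 1 + q = n + q + 1 by ring] at h2
  omega

/-! ### The three gap theorem -/

theorem Irrational.time_unique {α : ℝ} (hα : Irrational α) {p q s t : ℤ}
    (h : (p - s * α : ℝ) = q - t * α) : s = t := by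
  by_contra hne
  refine (hα.intCast_mul (sub_ne_zero.2 hne)).ne_int (p - q) ?_
  push_cast
  linarith

theorem Irrational.exists_small_pos {α : ℝ} (hα : Irrational α) {ε : ℝ} (hε : 0 < ε) :
    ∃ (t : ℕ) (p : ℤ), 0 < t ∧ 0 < p - t * α ∧ p - t * α < ε := by
  obtain ⟨n, hn⟩ := exists_nat_one_div_lt hε
  obtain ⟨j, k, hk, -, hjk⟩ := Real.exists_int_int_abs_mul_sub_le α n.succ_pos
  lift k to ℕ using hk.le
  have hk' : 0 < k := by exact_mod_cast hk
  set d : ℝ := j - k * α with hd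
  rw [abs_sub_comm] at hjk
  have hd1 : |d| ≤ 1 := hjk.trans (by
    rw [div_le_one (by positivity)]
    push_cast
    linarith [(n.cast_nonneg : (0 : ℝ) ≤ n)])
  have hdε : |d| < ε := by
    refine lt_of_le_of_lt hjk (lt_of_le_of_lt ?_ hn)
    push_cast
    apply one_div_le_one_div_of_le <;> linarith [(n.cast_nonneg : (0 : ℝ) ≤ n)]
  have hne : ∀ (t : ℕ) (p : ℤ), 0 < t → (p - t * α : ℝ) ≠ 0 := by
    intro t p ht h0
    have := hα.time_unique (p := p) (s := t) (q := 0) (t := 0) (by push_cast; linarith)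
    omega
  rcases (hne k j hk').lt_or_gt with hneg | hpos
  · have hd0 : 0 < -d := by linarith
    obtain ⟨m, hm, hm'⟩ : ∃ m : ℕ, (m : ℝ) * (-d) ≤ 1 ∧ 1 < (m + 1 : ℝ) * (-d) := by
      refine ⟨⌊1 / (-d)⌋₊, ?_, ?_⟩
      · rw [← le_div_iff₀ hd0]
        exact Nat.floor_le (by positivity)
      · rw [← div_lt_iff₀ hd0]
        exact Nat.lt_floor_add_one _
    rw [abs_of_neg hneg] at hdε hd1
    rcases Nat.eq_zero_or_pos m with rfl | hm0
    · push_cast at hm'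
      linarith
    · have h1 := hne (m * k) (m * j + 1) (by positivity)
      have h2 : ((m * j + 1 : ℤ) - (m * k : ℕ) * α : ℝ) = 1 - m * (-d) := by
        push_cast
        ring
      refine ⟨m * k, m * j + 1, by positivity, ?_, ?_⟩
      · rw [h2] at h1 ⊢
        exact lt_of_le_of_ne (by linarith) h1.symm
      · rw [h2]
        linarith
  · exact ⟨k, j, hk', hpos, (le_abs_self d).trans_lt hdε⟩

/-- `y` is an orbit of the rotation by `-α`, lifted to an interval of length `1`, and `O` is the
set of times at which it visits an interval. -/
structure IsRotationVisit (y : ℕ → ℝ) (α : ℝ) (O : Set ℕ) : Prop where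
  irrational : Irrational α
  step : ∀ i t : ℕ, ∃ p : ℤ, y (i + t) - y i = p - t * α
  spread : ∀ i j, y i - y j ≤ 1
  convex : ∀ i ∈ O, ∀ j ∈ O, ∀ k, y i < y k → y k < y j → k ∈ O
  infinite : O.Infinite

namespace IsRotationVisit

variable {y : ℕ → ℝ} {β : ℝ} {O : Set ℕ}

theorem neg (h : IsRotationVisit y β O) : IsRotationVisit (fun i => -y i) (-β) O where
  irrational := h.irrational.neg
  step i t := by
    obtain ⟨p, hp⟩ := h.step i t
    exact ⟨-p, by push_cast; linarith⟩
  spread i j := by linarith [h.spread j i]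
  convex i hi j hj k hik hkj := h.convex j hj i hi k (by linarith) (by linarith)
  infinite := h.infinite

theorem eq_add_of_sub_eq (h : IsRotationVisit y β O) {i j t : ℕ} {p : ℤ} (ht : 0 < t)
    (hij : y j - y i = p - t * β) : j = i + t := by
  rcases le_total i j with hle | hle
  · obtain ⟨s, rfl⟩ := Nat.exists_eq_add_of_le hle
    obtain ⟨q, hq⟩ := h.step i s
    have := h.irrational.time_unique (p := q) (s := s) (q := p) (t := t)
      (by push_cast; linarith)
    omega
  · obtain ⟨s, rfl⟩ := Nat.exists_eq_add_of_le hle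
    obtain ⟨q, hq⟩ := h.step j s
    have := h.irrational.time_unique (p := -q) (s := -s) (q := p) (t := t)
      (by push_cast; linarith)
    omega

theorem ne_add (h : IsRotationVisit y β O) (i : ℕ) {t : ℕ} (ht : 0 < t) : y (i + t) ≠ y i := by
  intro heq
  obtain ⟨p, hp⟩ := h.step i t
  have := h.irrational.time_unique (p := p) (s := t) (q := 0) (t := 0)
    (by push_cast; linarith)
  omega

theorem eq_of_pos (h : IsRotationVisit y β O) {i j t : ℕ} (hi : y i < y (i + t))
    (hj : y j < y (j + t)) : y (i + t) - y i = y (j + t) - y j := by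
  obtain ⟨p, hp⟩ := h.step i t
  obtain ⟨q, hq⟩ := h.step j t
  have h1 := h.spread (i + t) i
  have h2 := h.spread (j + t) j
  have h3 : p < q + 1 := by
    have : (p : ℝ) < q + 1 := by linarith
    exact_mod_cast this
  have h4 : q < p + 1 := by
    have : (q : ℝ) < p + 1 := by linarith
    exact_mod_cast this
  rw [hp, hq, show p = q by omega]

/-- A translate that falls strictly inside the visited interval is visited. -/
theorem mem_of_between (h : IsRotationVisit y β O) {i t e f : ℕ} {d : ℝ} {p : ℤ}
    (hd : d = p - t * β) (he : e ∈ O) (hf : f ∈ O) (hei : y e < y i + d) (hif : y i + d < y f) :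
    i + t ∈ O ∧ y (i + t) = y i + d := by
  obtain ⟨q, hq⟩ := h.step i t
  have h1 := h.spread (i + t) e
  have h2 := h.spread f (i + t)
  have h3 : p < q + 1 := by
    have : (p : ℝ) < q + 1 := by linarith
    exact_mod_cast this
  have h4 : q < p + 1 := by
    have : (q : ℝ) < p + 1 := by linarith
    exact_mod_cast this
  obtain rfl : p = q := by omega
  have h5 : y (i + t) = y i + d := by linarith
  exact ⟨h.convex e he f hf _ (by linarith) (by linarith), h5⟩

/-- Some visit is followed `t` steps later by another one at a higher level. -/
def Ascent (y : ℕ → ℝ) (O : Set ℕ) (t : ℕ) : Prop :=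
  0 < t ∧ ∃ i ∈ O, i + t ∈ O ∧ y i < y (i + t)

theorem exists_ascent (h : IsRotationVisit y β O) : ∃ t, Ascent y O t := by
  obtain ⟨i, hi, j, hj, hij⟩ : ∃ i ∈ O, ∃ j ∈ O, y i < y j := by
    obtain ⟨i, hi⟩ := h.infinite.nonempty
    obtain ⟨j, hj, hij⟩ := h.infinite.exists_gt i
    obtain ⟨t, rfl⟩ := Nat.exists_eq_add_of_lt hij
    rcases (h.ne_add i (t := t + 1) (by omega)).lt_or_gt with hlt | hlt
    · exact ⟨_, hj, _, hi, hlt⟩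
    · exact ⟨_, hi, _, hj, hlt⟩
  obtain ⟨t, p, ht, hpos, hlt⟩ := h.irrational.exists_small_pos (sub_pos.2 hij)
  obtain ⟨h1, h2⟩ := h.mem_of_between (i := i) (t := t) rfl hi hj
    (by linarith) (by linarith)
  exact ⟨t, ht, i, hi, h1, by linarith⟩

theorem add_le_of_ascending_return (h : IsRotationVisit y β O) {t₁ t₂ i t : ℕ}
    (h₁ : Ascent y O t₁) (hmin₁ : ∀ t, Ascent y O t → t₁ ≤ t)
    (hmin₂ : ∀ t, Ascent (fun i => -y i) O t → t₂ ≤ t)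
    (hi : i ∈ O) (hit : i + t ∈ O) (ht : 0 < t) (hret : ∀ s, 0 < s → s < t → i + s ∉ O)
    (hlt : y i < y (i + t)) (hne : t ≠ t₁) : t₁ + t₂ ≤ t := by
  obtain ⟨ht₁, i₁, hi₁, hit₁, hlt₁⟩ := h₁
  have hle := hmin₁ t ⟨ht, i, hi, hit, hlt⟩
  obtain ⟨p₁, hp₁⟩ := h.step i₁ t₁
  obtain ⟨p, hp⟩ := h.step i t
  have hlow : y (i + t) - y i < y (i₁ + t₁) - y i₁ := by
    by_contra! hge
    rcases hge.eq_or_lt with heq | hgt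
    · have := h.eq_add_of_sub_eq (j := i + t) (i := i) ht₁ (heq.symm.trans hp₁)
      omega
    · exact hret t₁ ht₁ (by omega)
        (h.mem_of_between hp₁ hi hit (by linarith) (by linarith)).1
  obtain ⟨s, rfl⟩ := Nat.exists_eq_add_of_le hle
  obtain ⟨h1, h2⟩ := h.mem_of_between (i := i₁ + t₁) (t := s) (p := p - p₁)
    (d := (y (i + (t₁ + s)) - y i) - (y (i₁ + t₁) - y i₁))
    (by rw [hp, hp₁]; push_cast; ring) hi₁ hit₁ (by linarith) (by linarith)
  have := hmin₂ s ⟨by omega, i₁ + t₁, hit₁, h1, by linarith⟩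
  omega

theorem exists_three_returns (h : IsRotationVisit y β O) :
    ∃ (P₁ P₂ P₃ : ℕ × ℝ), ∀ i ∈ O, ∀ t, 0 < t → i + t ∈ O →
      (∀ s, 0 < s → s < t → i + s ∉ O) → (t, y (i + t) - y i) ∈ ({P₁, P₂, P₃} : Set (ℕ × ℝ)) := by
  classical
  obtain ⟨t₁, h₁, hmin₁⟩ : ∃ t, Ascent y O t ∧ ∀ s, Ascent y O s → t ≤ s :=
    ⟨_, Nat.find_spec h.exists_ascent, fun s hs => Nat.find_min' _ hs⟩
  obtain ⟨t₂, h₂, hmin₂⟩ : ∃ t, Ascent (fun i => -y i) O t ∧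
      ∀ s, Ascent (fun i => -y i) O s → t ≤ s :=
    ⟨_, Nat.find_spec h.neg.exists_ascent, fun s hs => Nat.find_min' _ hs⟩
  obtain ⟨ht₁, i₁, hi₁, hit₁, hlt₁⟩ := id h₁
  obtain ⟨ht₂, i₂, hi₂, hit₂, hlt₂⟩ := id h₂
  refine ⟨(t₁, y (i₁ + t₁) - y i₁), (t₂, y (i₂ + t₂) - y i₂),
    (t₁ + t₂, (y (i₁ + t₁) - y i₁) + (y (i₂ + t₂) - y i₂)), fun i hi t ht hit hret => ?_⟩
  simp only [Set.mem_insert_iff, Set.mem_singleton_iff, Prod.mk.injEq]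
  by_cases hlong : t < t₁ + t₂
  · rcases (h.ne_add i ht).lt_or_gt with hlt | hlt
    · right; left
      have hlt' : -y i < -y (i + t) := by linarith
      have htt : t = t₂ := by
        by_contra hne
        have := h.neg.add_le_of_ascending_return h₂ hmin₂ (t₂ := t₁) (by simpa using hmin₁)
          hi hit ht hret hlt' hne
        omega
      subst htt
      have := h.neg.eq_of_pos hlt' hlt₂
      exact ⟨rfl, by linarith⟩
    · left
      have htt : t = t₁ := by
        by_contra hne
        have := h.add_le_of_ascending_return h₁ hmin₁ hmin₂ hi hit ht hret hlt hne
        omega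
      subst htt
      exact ⟨rfl, h.eq_of_pos hlt hlt₁⟩
  · right; right
    obtain ⟨p₁, hp₁⟩ := h.step i₁ t₁
    obtain ⟨p₂, hp₂⟩ := h.step i₂ t₂
    have hno₁ := hret t₁ ht₁ (by omega)
    have hno₂ := hret t₂ ht₂ (by omega)
    have hup : ∀ f ∈ O, y f ≤ y i + (y (i₁ + t₁) - y i₁) := by
      intro f hf
      by_contra! hlt
      exact hno₁ (h.mem_of_between hp₁ hi hf (by linarith) hlt).1
    have hdown : ∀ e ∈ O, y i + (y (i₂ + t₂) - y i₂) ≤ y e := by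
      intro e he
      by_contra! hlt
      exact hno₂ (h.mem_of_between hp₂ he hi hlt (by linarith)).1
    have hlow : y (i₂ + t₂) < y i + ((y (i₁ + t₁) - y i₁) + (y (i₂ + t₂) - y i₂)) := by
      have hne : y i₂ ≠ y i + (y (i₁ + t₁) - y i₁) := fun heq =>
        hno₁ (h.eq_add_of_sub_eq (j := i₂) (i := i) (p := p₁) ht₁ (by linarith) ▸ hi₂)
      linarith [lt_of_le_of_ne (hup i₂ hi₂) hne]
    have hhigh : y i + ((y (i₁ + t₁) - y i₁) + (y (i₂ + t₂) - y i₂)) < y (i₁ + t₁) := by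
      have hne : y i + (y (i₂ + t₂) - y i₂) ≠ y i₁ := fun heq =>
        hno₂ (h.eq_add_of_sub_eq (j := i₁) (i := i) (p := p₂) ht₂ (by linarith) ▸ hi₁)
      linarith [lt_of_le_of_ne (hdown i₁ hi₁) hne]
    obtain ⟨hmem, hval⟩ := h.mem_of_between (i := i) (t := t₁ + t₂) (p := p₁ + p₂)
      (by rw [hp₁, hp₂]; push_cast; ring) hit₂ hit₁ hlow hhigh
    have htt : t = t₁ + t₂ := by
      by_contra hne
      exact hret _ (by omega) (by omega) hmem
    subst htt
    exact ⟨rfl, by linarith⟩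

end IsRotationVisit

/-! ### Abelian returns -/

theorem perm_iff_count_true {u v : List Bool} (h : u.length = v.length) :
    u.Perm v ↔ u.count true = v.count true := by
  refine ⟨fun hp => hp.count_eq _, fun hc => List.perm_iff_count.2 ?_⟩
  have h1 := List.count_true_add_count_false (l := u)
  have h2 := List.count_true_add_count_false (l := v)
  rintro (_ | _) <;> omega

theorem mem_abelianOccurrences_iff (w : ℕ → Bool) (u : List Bool) (i : ℕ) :
    i ∈ AbelianOccurrences w u ↔
      prefixCount w (i + u.length) - prefixCount w i = u.count true := by
  rw [AbelianOccurrences, Set.mem_ofPred_eq, perm_iff_count_true (factorAt_length _ _ _),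
    ← count_factorAt]
  norm_cast

theorem Sturmian.infinite_abelianOccurrences {w : ℕ → Bool} (hw : Sturmian w) {u : List Bool}
    (hu : IsFactor w u) : (AbelianOccurrences w u).Infinite := by
  intro hfin
  obtain ⟨B, hB⟩ := hfin.bddAbove
  have hno : ∀ i, B < i → i ∉ AbelianOccurrences w u := fun i hi h => by
    have := hB h
    omega
  simp only [mem_abelianOccurrences_iff] at hno
  obtain ⟨i₀, hi₀⟩ := hu
  have hc : prefixCount w (i₀ + u.length) - prefixCount w i₀ = u.count true := by
    rw [← count_factorAt, hi₀]
  have hpos : 0 < u.length := by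
    by_contra! h0
    obtain rfl : u = [] := List.length_eq_zero_iff.1 (by omega)
    exact hno (B + 1) (by omega) (by simp)
  refine hw.not_ultimatelyPeriodic ⟨B + 1, u.length, hpos, fun n hn => ?_⟩
  apply apply_eq_of_prefixCount
  have a1 := hno n (by omega)
  have a2 := hno (n + 1) (by omega)
  have b1 := hw.balanced u.length n (n + 1)
  have b2 := hw.balanced u.length (n + 1) n
  have b3 := hw.balanced u.length n i₀
  have b4 := hw.balanced u.length i₀ n
  have b5 := hw.balanced u.length (n + 1) i₀
  have b6 := hw.balanced u.length i₀ (n + 1)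
  rw [show n + 1 + u.length = n + u.length + 1 by ring] at *
  omega

theorem isRotationVisit_abelianOccurrences {w : ℕ → Bool} (hw : Sturmian w) {u : List Bool}
    (hu : IsFactor w u) {β : ℝ}
    (hβ : ∀ i n : ℕ, |(prefixCount w (i + n) - prefixCount w i : ℝ) - n * β| ≤ 1) :
    IsRotationVisit (fun i => prefixCount w i - i * β) β (AbelianOccurrences w u) := by
  have hspread : ∀ i j : ℕ, ((prefixCount w i : ℝ) - i * β) - (prefixCount w j - j * β) ≤ 1 := by
    intro i j
    rcases le_total i j with hle | hle
    · obtain ⟨t, rfl⟩ := Nat.exists_eq_add_of_le hle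
      have := (abs_le.1 (hβ i t)).1
      push_cast
      linarith
    · obtain ⟨t, rfl⟩ := Nat.exists_eq_add_of_le hle
      have := (abs_le.1 (hβ j t)).2
      push_cast
      linarith
  refine ⟨hw.irrational_slope hβ, fun i t => ?_, hspread, fun i hi j hj k hik hkj => ?_,
    hw.infinite_abelianOccurrences hu⟩
  · exact ⟨prefixCount w (i + t) - prefixCount w i, by push_cast; ring⟩
  · rw [mem_abelianOccurrences_iff] at *
    have h1 := hspread (k + u.length) (i + u.length)
    have h2 := hspread (j + u.length) (k + u.length)
    push_cast at h1 h2
    have hi' : (prefixCount w (i + u.length) : ℝ) - prefixCount w i = u.count true := by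
      exact_mod_cast hi
    have hj' : (prefixCount w (j + u.length) : ℝ) - prefixCount w j = u.count true := by
      exact_mod_cast hj
    have h3 : prefixCount w (k + u.length) - prefixCount w k < u.count true + 1 := by
      have : (prefixCount w (k + u.length) : ℝ) - prefixCount w k < u.count true + 1 := by
        linarith
      exact_mod_cast this
    have h4 : (u.count true : ℤ) < prefixCount w (k + u.length) - prefixCount w k + 1 := by
      have : (u.count true : ℝ) < prefixCount w (k + u.length) - prefixCount w k + 1 := by
        linarith
      exact_mod_cast this
    omega

/-- The abelian class of binary words of length `t` having `p` occurrences of `true`. -/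
def binaryClass (t p : ℕ) : Multiset Bool :=
  Multiset.replicate p true + Multiset.replicate (t - p) false

theorem coe_factorAt_eq_binaryClass (w : ℕ → Bool) (i t : ℕ) :
    (factorAt w i t : Multiset Bool) =
      binaryClass t (prefixCount w (i + t) - prefixCount w i).toNat := by
  have h1 := List.count_true_add_count_false (l := factorAt w i t)
  rw [factorAt_length] at h1
  rw [← count_factorAt, Int.toNat_natCast, binaryClass]
  ext b
  cases b
  · simp [Multiset.count_replicate]
    omega
  · simp [Multiset.count_replicate]

theorem exists_next_mem {O : Set ℕ} (hO : O.Infinite) (i : ℕ) :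
    ∃ t, 0 < t ∧ i + t ∈ O ∧ ∀ s, 0 < s → s < t → i + s ∉ O := by
  classical
  have hex : ∃ t, 0 < t ∧ i + t ∈ O := by
    obtain ⟨j, hj, hij⟩ := hO.exists_gt i
    exact ⟨j - i, by omega, by rwa [Nat.add_sub_cancel' hij.le]⟩
  exact ⟨Nat.find hex, (Nat.find_spec hex).1, (Nat.find_spec hex).2,
    fun s hs hlt hmem => Nat.find_min hex hlt ⟨hs, hmem⟩⟩

theorem abelianReturnClasses_eq (w : ℕ → α) (u : List α) :
    abelianReturnClasses w u = {c | ∃ i t, i ∈ AbelianOccurrences w u ∧ 0 < t ∧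
      i + t ∈ AbelianOccurrences w u ∧
      (∀ s, 0 < s → s < t → i + s ∉ AbelianOccurrences w u) ∧
      c = (factorAt w i t : Multiset α)} := by
  ext c
  constructor
  · rintro ⟨_, ⟨i, j, hi, hj, hij, hno, rfl⟩, rfl⟩
    exact ⟨i, j - i, hi, by omega, by rwa [Nat.add_sub_cancel' hij.le],
      fun s hs hlt => hno _ (by omega) (by omega), rfl⟩
  · rintro ⟨i, t, hi, ht, hit, hno, rfl⟩
    refine ⟨_, ⟨i, i + t, hi, hit, by omega, fun k hik hkt => ?_, rfl⟩, by simp⟩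
    have := hno (k - i) (by omega) (by omega)
    rwa [Nat.add_sub_cancel' hik.le] at this

theorem encard_abelianReturnClasses_le {w : ℕ → Bool} {u : List Bool} {β : ℝ}
    (h : IsRotationVisit (fun i => prefixCount w i - i * β) β (AbelianOccurrences w u)) :
    (abelianReturnClasses w u).encard ≤ 3 := by
  obtain ⟨P₁, P₂, P₃, hP⟩ := h.exists_three_returns
  have hsub : abelianReturnClasses w u ⊆
      (fun x : ℕ × ℝ => binaryClass x.1 ⌊x.2 + x.1 * β⌋.toNat) '' {P₁, P₂, P₃} := by
    rw [abelianReturnClasses_eq]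
    rintro _ ⟨i, t, hi, ht, hit, hno, rfl⟩
    refine ⟨_, hP i hi t ht hit hno, ?_⟩
    rw [coe_factorAt_eq_binaryClass]
    dsimp only
    congr 2
    rw [Int.floor_eq_iff]
    push_cast
    constructor <;> linarith
  refine (Set.encard_le_encard hsub).trans ((Set.encard_image_le _ _).trans ?_)
  refine (Set.encard_insert_le _ _).trans ?_
  refine (add_le_add_left (Set.encard_insert_le _ _) _).trans ?_
  rw [Set.encard_singleton]
  norm_num

theorem one_lt_encard_abelianReturnClasses {w : ℕ → Bool} {u : List Bool} {β : ℝ}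
    (h : IsRotationVisit (fun i => prefixCount w i - i * β) β (AbelianOccurrences w u)) :
    1 < (abelianReturnClasses w u).encard := by
  by_contra! hle
  rw [Set.encard_le_one_iff, abelianReturnClasses_eq] at hle
  obtain ⟨i₀, hi₀⟩ := h.infinite.nonempty
  obtain ⟨T, hT, hiT, hnoT⟩ := exists_next_mem h.infinite i₀
  set y : ℕ → ℝ := fun i => prefixCount w i - i * β
  set d := y (i₀ + T) - y i₀ with hd
  have hstep : ∀ i ∈ AbelianOccurrences w u, i + T ∈ AbelianOccurrences w u ∧
      y (i + T) = y i + d := by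
    intro i hi
    obtain ⟨t, ht, hit, hno⟩ := exists_next_mem h.infinite i
    have heq := hle _ _ ⟨i, t, hi, ht, hit, hno, rfl⟩ ⟨i₀, T, hi₀, hT, hiT, hnoT, rfl⟩
    have hperm := Multiset.coe_eq_coe.1 heq
    obtain rfl : t = T := by simpa [factorAt_length] using hperm.length_eq
    refine ⟨hit, ?_⟩
    have hcount : prefixCount w (i + t) - prefixCount w i =
        prefixCount w (i₀ + t) - prefixCount w i₀ := by
      rw [← count_factorAt, ← count_factorAt, hperm.count_eq]
    have hcount' : (prefixCount w (i + t) : ℝ) - prefixCount w i =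
        prefixCount w (i₀ + t) - prefixCount w i₀ := by exact_mod_cast hcount
    simp only [hd, y]
    push_cast
    linarith
  have hiter : ∀ n : ℕ, ∃ i ∈ AbelianOccurrences w u, y i = y i₀ + n * d := by
    intro n
    induction n with
    | zero => exact ⟨i₀, hi₀, by simp⟩
    | succ n ih =>
      obtain ⟨i, hi, hy⟩ := ih
      obtain ⟨h1, h2⟩ := hstep i hi
      exact ⟨_, h1, by rw [h2, hy]; push_cast; ring⟩
  have hd0 : 0 < |d| := abs_pos.2 (sub_ne_zero.2 (h.ne_add i₀ hT))
  obtain ⟨n, hn⟩ := exists_nat_gt (1 / |d|)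
  rw [div_lt_iff₀ hd0] at hn
  obtain ⟨i, -, hi⟩ := hiter n
  have h1 : |y i - y i₀| ≤ 1 := abs_le.2 ⟨by linarith [h.spread i₀ i], h.spread i i₀⟩
  rw [hi, add_sub_cancel_left, abs_mul, Nat.abs_cast] at h1
  linarith

/-- Each factor of a Sturmian word has two or three abelian returns. -/
theorem sturmian_factor_two_or_three_abelian_returns (w : ℕ → Bool) (hw : Sturmian w)
    (u : List Bool) (hu : IsFactor w u) :
    (abelianReturnClasses w u).encard = 2 ∨ (abelianReturnClasses w u).encard = 3 := by
  obtain ⟨β, hβ⟩ := hw.exists_slope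
  have h := isRotationVisit_abelianOccurrences hw hu hβ
  have h3 := encard_abelianReturnClasses_le h
  have h2 := one_lt_encard_abelianReturnClasses h
  have hfin : (abelianReturnClasses w u).Finite :=
    Set.finite_of_encard_le_coe (k := 3) (by simpa using h3)
  rw [hfin.encard_eq_coe_toFinset_card] at h2 h3 ⊢
  norm_cast at h2 h3 ⊢
  omega
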